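/- arXiv:2008.03442 — 3 statements merged into one kernel-verified Lean document; each statement's English description precedes it below -/
import Mathlib

section
/- Let H : E × E × ℝ → ℝ be C¹ with (∂H/∂u)(x,p,u) ≥ λ for some λ > 0 and all (x,p,u), and let z : [0,∞) → E × E × ℝ be a solution of the contact Hamiltonian ODE associated to H. If (t_k) is a sequence with t_k → ∞ and z(t_k) → w for some point w ∈ E × E × ℝ, then H(w) = 0. In particular every ω-limit point of the orbit lies in the zero level set H⁻¹(0). -/
open scoped RealInnerProductSpace

noncomputable def pgradX {n : ℕ}
    (H : EuclideanSpace ℝ (Fin n) × EuclideanSpace ℝ (Fin n) × ℝ → ℝ)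
    (z : EuclideanSpace ℝ (Fin n) × EuclideanSpace ℝ (Fin n) × ℝ) :
    EuclideanSpace ℝ (Fin n) :=
  gradient (fun x => H (x, z.2.1, z.2.2)) z.1

noncomputable def pgradP {n : ℕ}
    (H : EuclideanSpace ℝ (Fin n) × EuclideanSpace ℝ (Fin n) × ℝ → ℝ)
    (z : EuclideanSpace ℝ (Fin n) × EuclideanSpace ℝ (Fin n) × ℝ) :
    EuclideanSpace ℝ (Fin n) :=
  gradient (fun p => H (z.1, p, z.2.2)) z.2.1

noncomputable def pderivU {n : ℕ}
    (H : EuclideanSpace ℝ (Fin n) × EuclideanSpace ℝ (Fin n) × ℝ → ℝ)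
    (z : EuclideanSpace ℝ (Fin n) × EuclideanSpace ℝ (Fin n) × ℝ) : ℝ :=
  deriv (fun u => H (z.1, z.2.1, u)) z.2.2

/-- `z = (x,p,u)` solves the contact Hamiltonian ODE associated to `H` on `I`. -/
def IsContactSol {n : ℕ}
    (H : EuclideanSpace ℝ (Fin n) × EuclideanSpace ℝ (Fin n) × ℝ → ℝ)
    (I : Set ℝ) (x p : ℝ → EuclideanSpace ℝ (Fin n)) (u : ℝ → ℝ) : Prop :=
  ∀ t ∈ I,
    HasDerivAt x (pgradP H (x t, p t, u t)) t ∧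
    HasDerivAt p (-pgradX H (x t, p t, u t) - pderivU H (x t, p t, u t) • p t) t ∧
    HasDerivAt u (⟪pgradP H (x t, p t, u t), p t⟫ - H (x t, p t, u t)) t

theorem fderiv_apply_eq_partials {n : ℕ}
    {H : EuclideanSpace ℝ (Fin n) × EuclideanSpace ℝ (Fin n) × ℝ → ℝ}
    {z : EuclideanSpace ℝ (Fin n) × EuclideanSpace ℝ (Fin n) × ℝ}
    (hH : DifferentiableAt ℝ H z) (a b : EuclideanSpace ℝ (Fin n)) (c : ℝ) :
    fderiv ℝ H z (a, b, c) = ⟪pgradX H z, a⟫ + ⟪pgradP H z, b⟫ + pderivU H z * c := by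
  obtain ⟨x, p, u⟩ := z
  have hX : HasFDerivAt (fun y => H (y, p, u)) _ x :=
    HasFDerivAt.comp (f := fun y => (y, p, u)) x hH.hasFDerivAt
      (hasFDerivAt_prodMk_left (𝕜 := ℝ) x (p, u))
  have hP : HasFDerivAt (fun y => H (x, y, u)) _ p :=
    HasFDerivAt.comp (f := fun y => (x, y, u)) p hH.hasFDerivAt
      ((hasFDerivAt_prodMk_right (𝕜 := ℝ) x (p, u)).comp p
        (hasFDerivAt_prodMk_left (𝕜 := ℝ) p u))
  have hU : HasDerivAt (fun y => H (x, p, y)) (fderiv ℝ H (x, p, u) (0, 0, 1)) u :=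
    HasFDerivAt.comp_hasDerivAt (f := fun y => (x, p, y)) u hH.hasFDerivAt
      ((hasDerivAt_const u x).prodMk ((hasDerivAt_const u p).prodMk (hasDerivAt_id u)))
  have eX : ⟪pgradX H (x, p, u), a⟫ = fderiv ℝ H (x, p, u) (a, 0, 0) := by
    simp only [pgradX, gradient, InnerProductSpace.toDual_symm_apply, hX.fderiv]
    rfl
  have eP : ⟪pgradP H (x, p, u), b⟫ = fderiv ℝ H (x, p, u) (0, b, 0) := by
    simp only [pgradP, gradient, InnerProductSpace.toDual_symm_apply, hP.fderiv]
    simp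
  have eU : pderivU H (x, p, u) * c = fderiv ℝ H (x, p, u) (0, 0, c) := by
    simp only [pderivU, hU.deriv]
    rw [mul_comm, ← smul_eq_mul, ← map_smul]
    simp
  rw [eX, eP, eU, ← map_add, ← map_add]
  simp

/-- Along a contact Hamiltonian orbit the Hamiltonian satisfies `h' = -(∂H/∂u) h`. -/
theorem IsContactSol.hasDerivAt_hamiltonian {n : ℕ}
    {H : EuclideanSpace ℝ (Fin n) × EuclideanSpace ℝ (Fin n) × ℝ → ℝ} (hH : Differentiable ℝ H)
    {I : Set ℝ} {x p : ℝ → EuclideanSpace ℝ (Fin n)} {u : ℝ → ℝ}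
    (hsol : IsContactSol H I x p u) {t : ℝ} (ht : t ∈ I) :
    HasDerivAt (fun s => H (x s, p s, u s))
      (-(pderivU H (x t, p t, u t) * H (x t, p t, u t))) t := by
  obtain ⟨hx, hp, hu⟩ := hsol t ht
  have h := HasFDerivAt.comp_hasDerivAt (f := fun s => (x s, p s, u s)) t
    (hH (x t, p t, u t)).hasFDerivAt (hx.prodMk (hp.prodMk hu))
  rw [fderiv_apply_eq_partials (hH _)] at h
  refine h.congr_deriv ?_
  rw [inner_sub_right, inner_neg_right, inner_smul_right, real_inner_comm (pgradP H _) (pgradX H _)]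
  ring

/-- If `h' = -c h` on `[0, ∞)` with `c ≥ lam > 0`, then `h` tends to `0` at infinity. -/
theorem tendsto_zero_of_hasDerivAt_neg_mul {h c : ℝ → ℝ} {lam : ℝ} (hlam : 0 < lam)
    (hc : ∀ t, lam ≤ c t) (hd : ∀ t, 0 ≤ t → HasDerivAt h (-(c t * h t)) t) :
    Filter.Tendsto h Filter.atTop (nhds 0) := by
  have hg : ∀ t, 0 ≤ t → HasDerivAt (fun s => Real.exp (2 * lam * s) * h s ^ 2)
      (2 * Real.exp (2 * lam * t) * ((lam - c t) * h t ^ 2)) t := by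
    intro t ht
    have he := ((hasDerivAt_id t).const_mul (2 * lam)).exp
    refine (he.mul ((hd t ht).pow 2)).congr_deriv ?_
    simp only [id, Pi.pow_apply]
    push_cast
    ring
  have hanti : AntitoneOn (fun s => Real.exp (2 * lam * s) * h s ^ 2) (Set.Ici 0) := by
    apply antitoneOn_of_deriv_nonpos (convex_Ici 0)
    · exact fun t ht => (hg t ht).continuousAt.continuousWithinAt
    · exact fun t ht => (hg t (interior_subset ht)).differentiableAt.differentiableWithinAt
    · intro t ht
      rw [(hg t (interior_subset ht)).deriv]
      exact mul_nonpos_of_nonneg_of_nonpos (by positivity)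
        (mul_nonpos_of_nonpos_of_nonneg (sub_nonpos.2 (hc t)) (sq_nonneg _))
  have hlim : Filter.Tendsto (fun t => Real.exp (-(2 * lam * t)) * h 0 ^ 2)
      Filter.atTop (nhds 0) := by
    simpa using (Real.tendsto_exp_neg_atTop_nhds_zero.comp
      (Filter.tendsto_id.const_mul_atTop (by positivity : 0 < 2 * lam))).mul_const (h 0 ^ 2)
  have hsq : Filter.Tendsto (fun t => h t ^ 2) Filter.atTop (nhds 0) := by
    refine squeeze_zero' (Filter.Eventually.of_forall fun t => sq_nonneg _) ?_ hlim
    filter_upwards [Filter.eventually_ge_atTop 0] with t ht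
    have := hanti Set.self_mem_Ici ht ht
    simp only [mul_zero, Real.exp_zero, one_mul] at this
    rw [Real.exp_neg, inv_mul_eq_div, le_div_iff₀ (Real.exp_pos _), mul_comm]
    exact this
  rw [tendsto_zero_iff_abs_tendsto_zero]
  simpa [Function.comp_def, Real.sqrt_sq_eq_abs] using hsq.sqrt

theorem stmt_2 {n : ℕ} (hn : 1 ≤ n)
    (H : EuclideanSpace ℝ (Fin n) × EuclideanSpace ℝ (Fin n) × ℝ → ℝ) (hH : ContDiff ℝ 1 H)
    (lam : ℝ) (hlam : 0 < lam) (hmono : ∀ z, lam ≤ pderivU H z)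
    (x p : ℝ → EuclideanSpace ℝ (Fin n)) (u : ℝ → ℝ)
    (hsol : IsContactSol H (Set.Ici (0:ℝ)) x p u)
    (w : EuclideanSpace ℝ (Fin n) × EuclideanSpace ℝ (Fin n) × ℝ) (tk : ℕ → ℝ) (htk0 : ∀ k, 0 ≤ tk k)
    (htk : Filter.Tendsto tk Filter.atTop Filter.atTop)
    (hconv : Filter.Tendsto (fun k => (x (tk k), p (tk k), u (tk k)))
      Filter.atTop (nhds w)) :
    H w = 0 := by
  have hlim := tendsto_zero_of_hasDerivAt_neg_mul hlam (fun t => hmono (x t, p t, u t))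
    fun t ht => hsol.hasDerivAt_hamiltonian (hH.differentiable one_ne_zero) ht
  exact tendsto_nhds_unique ((hH.continuous.tendsto w).comp hconv) (hlim.comp htk)
end

section
/- Let H : E × E × ℝ → ℝ be C¹ such that p ↦ H(x,p,u) is convex for every (x,u) and (∂H/∂u)(x,p,u) ≥ λ for some λ > 0 and all (x,p,u). Let u₋ : E → ℝ be a C¹ function satisfying H(x, ∇u₋(x), u₋(x)) = 0 for every x ∈ E. If z = (x,p,u) : ℝ → E × E × ℝ is a solution of the contact Hamiltonian ODE associated to H defined on all of ℝ whose range is contained in a compact set, then u(t) ≥ u₋(x(t)) for all t ∈ ℝ. -/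
open scoped RealInnerProductSpace

/-- The gradient inequality for convex functions. -/
lemma ConvexOn.add_inner_gradient_le {F : Type*} [NormedAddCommGroup F] [InnerProductSpace ℝ F]
    [CompleteSpace F] {f : F → ℝ} (hf : ConvexOn ℝ Set.univ f) {a b : F}
    (hd : DifferentiableAt ℝ f a) :
    f a + ⟪gradient f a, b - a⟫ ≤ f b := by
  have hg : ConvexOn ℝ Set.univ (fun s : ℝ => f (AffineMap.lineMap a b s)) :=
    hf.comp_affineMap (AffineMap.lineMap a b : ℝ →ᵃ[ℝ] F)
  have h0 : HasFDerivAt f (fderiv ℝ f a) (AffineMap.lineMap a b (0 : ℝ)) := by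
    simpa using hd.hasFDerivAt
  have hder := h0.comp_hasDerivAt (0 : ℝ) AffineMap.hasDerivAt_lineMap
  have h := hg.le_slope_of_hasDerivAt (Set.mem_univ 0) (Set.mem_univ 1) one_pos hder
  simp only [slope_def_field, AffineMap.lineMap_apply_one, AffineMap.lineMap_apply_zero, sub_zero,
    div_one] at h
  rw [gradient, InnerProductSpace.toDual_symm_apply]
  linarith

/-- A function on `ℝ` which decays at rate at least `lam` wherever it is positive, and which is
bounded above, is nowhere positive. -/
lemma nonpos_of_deriv_le_neg_mul_of_bddAbove {w w' : ℝ → ℝ} {lam M : ℝ} (hlam : 0 < lam)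
    (hw : ∀ t, HasDerivAt w (w' t) t) (hw' : ∀ t, 0 < w t → w' t ≤ -lam * w t)
    (hM : ∀ t, w t ≤ M) (t : ℝ) : w t ≤ 0 := by
  by_contra! ht
  have hc : 0 < lam * w t / 2 := by positivity
  have hf : ∀ s, HasDerivAt (fun s => -w (t - s)) (w' (t - s)) s := fun s => by
    have h := ((hw (t - s)).comp_const_sub t s).neg
    rw [neg_neg] at h
    exact h
  have hB : ∀ s, HasDerivAt (fun s => -(w t + lam * w t / 2 * s)) (-(lam * w t / 2)) s :=
    fun s => by
      have h := (((hasDerivAt_id s).const_mul (lam * w t / 2)).const_add (w t)).neg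
      rw [mul_one] at h
      exact h
  have key : ∀ b, 0 ≤ b → w t + lam * w t / 2 * b ≤ w (t - b) := fun b hb => by
    have := image_le_of_deriv_right_lt_deriv_boundary (a := 0) (b := b)
      (fun s _ => (hf s).continuousAt.continuousWithinAt)
      (fun s _ => (hf s).hasDerivWithinAt) (by simp) hB
      (fun s hs h => by
        have h1 : w (t - s) = w t + lam * w t / 2 * s := neg_injective h
        have h2 : 0 ≤ lam * w t / 2 * s := mul_nonneg hc.le hs.1
        have h3 := hw' (t - s) (by linarith)
        have h4 : lam * w t ≤ lam * w (t - s) := mul_le_mul_of_nonneg_left (by linarith) hlam.le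
        linarith) (Set.right_mem_Icc.2 hb)
    exact neg_le_neg_iff.1 this
  have hMt := hM t
  have h := key (M / (lam * w t / 2)) (div_nonneg (by linarith) hc.le)
  rw [mul_div_cancel₀ _ hc.ne'] at h
  linarith [hM (t - M / (lam * w t / 2))]

theorem stmt_12 {n : ℕ} (hn : 1 ≤ n)
    (H : EuclideanSpace ℝ (Fin n) × EuclideanSpace ℝ (Fin n) × ℝ → ℝ) (hH : ContDiff ℝ 1 H)
    (hconv : ∀ (x : EuclideanSpace ℝ (Fin n)) (u : ℝ), ConvexOn ℝ Set.univ (fun p => H (x, p, u)))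
    (lam : ℝ) (hlam : 0 < lam) (hmono : ∀ z, lam ≤ pderivU H z)
    (um : EuclideanSpace ℝ (Fin n) → ℝ) (hum : ContDiff ℝ 1 um)
    (hHJ : ∀ x : EuclideanSpace ℝ (Fin n), H (x, gradient um x, um x) = 0)
    (x p : ℝ → EuclideanSpace ℝ (Fin n)) (u : ℝ → ℝ)
    (hsol : IsContactSol H Set.univ x p u)
    (C : Set (EuclideanSpace ℝ (Fin n) × EuclideanSpace ℝ (Fin n) × ℝ)) (hC : IsCompact C)
    (hrange : ∀ t : ℝ, (x t, p t, u t) ∈ C) :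
    ∀ t : ℝ, um (x t) ≤ u t := by
  have hd : Differentiable ℝ H := hH.differentiable one_ne_zero
  have hdm : Differentiable ℝ um := hum.differentiable one_ne_zero
  obtain ⟨M, hM⟩ := hC.bddAbove_image (f := fun z => um z.1 - z.2.2)
    ((hum.continuous.comp continuous_fst).sub continuous_snd.snd).continuousOn
  have hw : ∀ t, HasDerivAt (fun t => um (x t) - u t)
      (⟪gradient um (x t), pgradP H (x t, p t, u t)⟫ -
        (⟪pgradP H (x t, p t, u t), p t⟫ - H (x t, p t, u t))) t := fun t => by
    obtain ⟨hx, -, hu⟩ := hsol t (Set.mem_univ t)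
    have h := (hdm (x t)).hasFDerivAt.comp_hasDerivAt t hx
    rw [gradient, InnerProductSpace.toDual_symm_apply]
    exact h.sub hu
  intro t
  refine sub_nonpos.1 (nonpos_of_deriv_le_neg_mul_of_bddAbove hlam hw (fun s hs => ?_)
    (fun s => hM ⟨_, hrange s, rfl⟩) t)
  have hgrad := (hconv (x s) (u s)).add_inner_gradient_le (a := p s) (b := gradient um (x s))
    (by fun_prop)
  have hu : lam * (um (x s) - u s) ≤
      H (x s, gradient um (x s), um (x s)) - H (x s, gradient um (x s), u s) :=
    mul_sub_le_image_sub_of_le_deriv (f := fun v => H (x s, gradient um (x s), v)) (by fun_prop)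
      (fun v => hmono (x s, gradient um (x s), v)) (sub_nonneg.1 hs.le)
  rw [hHJ] at hu
  rw [inner_sub_right] at hgrad
  rw [real_inner_comm]
  simp only [pgradP] at *
  linarith
end

section
/- Let H : E × E × ℝ → ℝ be C² such that for every (x,u) the Hessian of p ↦ H(x,p,u) is positive definite at every p, and (∂H/∂p)(x,0,u) = 0 for every (x,u). Let z = (x,p,u) : ℝ → E × E × ℝ be a solution of the contact Hamiltonian ODE associated to H, defined on all of ℝ, with H(z(t)) = 0 for all t. Suppose z(t) → (x₀, 0, u₀) as t → −∞ and z(t) → (x₁, 0, u₁) as t → +∞, and that p(t*) ≠ 0 for some t* ∈ ℝ. Then u₀ < u₁. -/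
open scoped RealInnerProductSpace

/-- A `C²` function with positive definite Hessian and a critical point at the origin has positive
radial derivative away from the origin. -/
theorem inner_gradient_pos_of_hessian_pos {E : Type*} [NormedAddCommGroup E]
    [InnerProductSpace ℝ E] [CompleteSpace E] {f : E → ℝ} (hf : ContDiff ℝ 2 f)
    (hhess : ∀ p w : E, w ≠ 0 → 0 < iteratedFDeriv ℝ 2 f p ![w, w])
    (h0 : gradient f 0 = 0) {p : E} (hp : p ≠ 0) : 0 < ⟪gradient f p, p⟫ := by
  have hgrad (q : E) : ⟪gradient f q, p⟫ = fderiv ℝ f q p := by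
    simp [gradient]
  have hd : Differentiable ℝ (fderiv ℝ f) :=
    (hf.fderiv_right (m := 1) (by norm_num)).differentiable (by norm_num)
  have hderiv (s : ℝ) :
      HasDerivAt (fun s : ℝ => fderiv ℝ f (s • p) p) (fderiv ℝ (fderiv ℝ f) (s • p) p p) s := by
    have h1 : HasDerivAt (fun s : ℝ => s • p) p s := by
      simpa using (hasDerivAt_id s).smul_const p
    have h2 := (hd (s • p)).hasFDerivAt.comp_hasDerivAt s h1
    simpa using h2.clm_apply (hasDerivAt_const s p)
  have hmono : StrictMono (fun s : ℝ => fderiv ℝ f (s • p) p) := by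
    refine strictMono_of_deriv_pos fun s => ?_
    rw [(hderiv s).deriv]
    simpa [iteratedFDeriv_two_apply] using hhess (s • p) p hp
  have h := hmono zero_lt_one
  simp only [zero_smul, one_smul, ← hgrad, h0, inner_zero_left] at h
  exact h

/-- A monotone function with limits at both ends and a positive derivative somewhere has distinct
limits. -/
theorem lt_of_tendsto_of_monotone_of_hasDerivAt_pos {u : ℝ → ℝ} (hu : Monotone u) {a b c t : ℝ}
    (ha : Filter.Tendsto u Filter.atBot (nhds a)) (hb : Filter.Tendsto u Filter.atTop (nhds b))
    (ht : HasDerivAt u c t) (hc : 0 < c) : a < b := by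
  refine lt_of_le_of_ne ((hu.le_of_tendsto ha t).trans (hu.ge_of_tendsto hb t)) fun hab => ?_
  have hconst : u = fun _ => a := funext fun s =>
    le_antisymm (hab ▸ hu.ge_of_tendsto hb s) (hu.le_of_tendsto ha s)
  rw [hconst] at ht
  exact hc.ne' (ht.unique (hasDerivAt_const t a))


theorem stmt_15 {n : ℕ} (hn : 1 ≤ n)
    (H : EuclideanSpace ℝ (Fin n) × EuclideanSpace ℝ (Fin n) × ℝ → ℝ) (hH : ContDiff ℝ 2 H)
    (hhess : ∀ (x : EuclideanSpace ℝ (Fin n)) (u : ℝ) (p w : EuclideanSpace ℝ (Fin n)), w ≠ 0 →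
      0 < iteratedFDeriv ℝ 2 (fun q => H (x, q, u)) p ![w, w])
    (hp0 : ∀ (x : EuclideanSpace ℝ (Fin n)) (u : ℝ), pgradP H (x, (0 : EuclideanSpace ℝ (Fin n)), u) = 0)
    (x p : ℝ → EuclideanSpace ℝ (Fin n)) (u : ℝ → ℝ)
    (hsol : IsContactSol H Set.univ x p u)
    (hH0 : ∀ t : ℝ, H (x t, p t, u t) = 0)
    (x₀ x₁ : EuclideanSpace ℝ (Fin n)) (u₀ u₁ : ℝ)
    (hlimm : Filter.Tendsto (fun t => (x t, p t, u t)) Filter.atBot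
      (nhds (x₀, (0 : EuclideanSpace ℝ (Fin n)), u₀)))
    (hlimp : Filter.Tendsto (fun t => (x t, p t, u t)) Filter.atTop
      (nhds (x₁, (0 : EuclideanSpace ℝ (Fin n)), u₁)))
    (ts : ℝ) (hps : p ts ≠ 0) :
    u₀ < u₁ := by
  have hpos (t : ℝ) (ht : p t ≠ 0) : 0 < ⟪pgradP H (x t, p t, u t), p t⟫ :=
    inner_gradient_pos_of_hessian_pos (f := fun q => H (x t, q, u t)) (by fun_prop)
      (hhess (x t) (u t)) (hp0 (x t) (u t)) ht
  have hu (t : ℝ) : HasDerivAt u ⟪pgradP H (x t, p t, u t), p t⟫ t := by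
    simpa [hH0 t] using (hsol t (Set.mem_univ t)).2.2
  have hmono : Monotone u := by
    refine monotone_of_deriv_nonneg (fun t => (hu t).differentiableAt) fun t => ?_
    rw [(hu t).deriv]
    by_cases ht : p t = 0
    · simp [ht]
    · exact (hpos t ht).le
  exact lt_of_tendsto_of_monotone_of_hasDerivAt_pos hmono hlimm.snd_nhds.snd_nhds
    hlimp.snd_nhds.snd_nhds (hu ts) (hpos ts hps)
end
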